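/- arXiv:1912.01225 — 6 statements merged into one kernel-verified Lean document; each statement's English description precedes it below -/
import Mathlib

section
/- Let K be a field, A a commutative K-algebra whose module of Kähler differentials Ω_{A/K} is a free A-module, B a commutative K-algebra, and π : A → B a surjective K-algebra homomorphism. Then every derivation D of B lifts to a derivation D̃ of A satisfying π ∘ D̃ = D ∘ π (so every quotient algebra of A is a submanifold algebra of A). -/
/-- If `Ω[A⁄K]` is projective, derivations lift along surjective `A`-linear maps. -/
theorem Derivation.exists_compDer_eq_of_projective {K A M N : Type*} [CommRing K] [CommRing A]
    [Algebra K A] [AddCommGroup M] [Module K M] [Module A M] [IsScalarTower K A M]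
    [AddCommGroup N] [Module K N] [Module A N] [IsScalarTower K A N]
    [Module.Projective A (Ω[A⁄K])] (f : M →ₗ[A] N) (hf : Function.Surjective f)
    (d : Derivation K A N) : ∃ d' : Derivation K A M, f.compDer d' = d := by
  obtain ⟨g, hg⟩ := Module.projective_lifting_property f d.liftKaehlerDifferential hf
  refine ⟨g.compDer (KaehlerDifferential.D K A), ?_⟩
  ext a
  simpa using LinearMap.congr_fun hg (KaehlerDifferential.D K A a)

/-- If `A` is a commutative `K`-algebra whose module of Kähler differentials is free,
then every quotient of `A` is a submanifold algebra: every derivation of a quotient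
lifts along the quotient map. -/
theorem free_kaehler_quotients_are_submanifold_algebras
    {K A B : Type} [Field K] [CommRing A] [CommRing B] [Algebra K A] [Algebra K B]
    (hfree : Module.Free A (Ω[A⁄K]))
    (π : A →ₐ[K] B) (hπ : Function.Surjective π)
    (D : B →ₗ[K] B) (hD : ∀ a b, D (a * b) = D a * b + a * D b) :
    ∃ Dt : A →ₗ[K] A, (∀ a b, Dt (a * b) = Dt a * b + a * Dt b) ∧
      ∀ a, π (Dt a) = D (π a) := by
  algebraize [π.toRingHom]
  have : IsScalarTower K A B := IsScalarTower.of_algebraMap_eq fun k => (π.commutes k).symm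
  let d : Derivation K B B := Derivation.mk' D fun a b => by
    rw [hD, smul_eq_mul, smul_eq_mul]
    ring
  obtain ⟨d', hd'⟩ := Derivation.exists_compDer_eq_of_projective
    (Algebra.linearMap A B) hπ (d.compAlgebraMap A)
  refine ⟨d'.toLinearMap, fun a b => ?_, fun a => Derivation.congr_fun hd' a⟩
  change d' (a * b) = d' a * b + a * d' b
  rw [d'.leibniz, smul_eq_mul, smul_eq_mul]
  ring
end

section
/- Let K be a field, S a set, A := K⟨S⟩ the free associative unital K-algebra generated by S, B an associative unital K-algebra, and π : A → B a surjective K-algebra homomorphism. Then every derivation D of B lifts: there exists a derivation D̃ of A such that π ∘ D̃ = D ∘ π (and automatically D̃(ker π) ⊆ ker π). Hence every quotient algebra of a free algebra is a submanifold algebra. -/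
/-- Every function `d : S → K⟨S⟩` extends to a derivation of the free algebra `K⟨S⟩`. It is the
second component of the algebra homomorphism `s ↦ s + d s ε` into the dual numbers over `K⟨S⟩`. -/
theorem FreeAlgebra.exists_derivation_extending {R X : Type*} [CommRing R]
    (d : X → FreeAlgebra R X) :
    ∃ D : FreeAlgebra R X →ₗ[R] FreeAlgebra R X,
      (∀ a b, D (a * b) = D a * b + a * D b) ∧ ∀ x, D (FreeAlgebra.ι R x) = d x := by
  let f : FreeAlgebra R X →ₐ[R] TrivSqZeroExt (FreeAlgebra R X) (FreeAlgebra R X) :=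
    FreeAlgebra.lift R fun x => TrivSqZeroExt.inl (FreeAlgebra.ι R x) + TrivSqZeroExt.inr (d x)
  have hf : ∀ x, f (FreeAlgebra.ι R x) =
      TrivSqZeroExt.inl (FreeAlgebra.ι R x) + TrivSqZeroExt.inr (d x) := fun x =>
    FreeAlgebra.lift_ι_apply _ x
  have hfst : ∀ a, (f a).fst = a := by
    intro a
    induction a using FreeAlgebra.induction with
    | grade0 r => rw [AlgHom.commutes]; rfl
    | grade1 x => simp [hf]
    | mul a b ha hb => rw [map_mul, TrivSqZeroExt.fst_mul, ha, hb]
    | add a b ha hb => rw [map_add, TrivSqZeroExt.fst_add, ha, hb]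
  refine ⟨(TrivSqZeroExt.sndHom _ _).restrictScalars R ∘ₗ f.toLinearMap, fun a b => ?_,
    fun x => ?_⟩
  · simp [TrivSqZeroExt.snd_mul, hfst, add_comm]
  · simp [hf]

/-- A derivation of a free algebra that lifts a derivation of `B` along `π` on the generators
lifts it everywhere. -/
theorem FreeAlgebra.map_derivation_eq {R X B : Type*} [CommRing R] [Ring B] [Algebra R B]
    (π : FreeAlgebra R X →ₐ[R] B) (D : B →ₗ[R] B) (hD : ∀ a b, D (a * b) = D a * b + a * D b)
    (E : FreeAlgebra R X →ₗ[R] FreeAlgebra R X) (hE : ∀ a b, E (a * b) = E a * b + a * E b)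
    (h : ∀ x, π (E (FreeAlgebra.ι R x)) = D (π (FreeAlgebra.ι R x))) (a : FreeAlgebra R X) :
    π (E a) = D (π a) := by
  induction a using FreeAlgebra.induction with
  | grade0 r =>
    have hD1 : D 1 = 0 := by simpa using hD 1 1
    have hE1 : E 1 = 0 := by simpa using hE 1 1
    simp [Algebra.algebraMap_eq_smul_one, hD1, hE1]
  | grade1 x => exact h x
  | mul a b ha hb => simp [hE, hD, ha, hb]
  | add a b ha hb => simp [ha, hb]


/-- Every quotient of a free associative algebra `K⟨S⟩` is a submanifold algebra:
every derivation of the quotient lifts to a derivation of the free algebra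
(which automatically preserves the kernel of the quotient map). -/
theorem free_algebra_quotients_are_submanifold_algebras
    {K : Type} [Field K] {S : Type} {B : Type} [Ring B] [Algebra K B]
    (π : FreeAlgebra K S →ₐ[K] B) (hπ : Function.Surjective π)
    (D : B →ₗ[K] B) (hD : ∀ a b, D (a * b) = D a * b + a * D b) :
    ∃ Dt : FreeAlgebra K S →ₗ[K] FreeAlgebra K S,
      (∀ a b, Dt (a * b) = Dt a * b + a * Dt b) ∧
      (∀ a, π (Dt a) = D (π a)) ∧
      ∀ a, π a = 0 → π (Dt a) = 0 := by
  choose d hd using fun x => hπ (D (π (FreeAlgebra.ι K x)))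
  obtain ⟨Dt, hDt, hι⟩ := FreeAlgebra.exists_derivation_extending d
  have hlift := FreeAlgebra.map_derivation_eq π D hD Dt hDt fun x => by rw [hι, hd]
  exact ⟨Dt, hDt, hlift, fun a ha => by rw [hlift, ha, map_zero]⟩
end

section
/- Let S := {(x,y) ∈ ℝ² : xy = 0} be the coordinate cross in ℝ², I(S) ⊆ C^∞(ℝ²) its vanishing ideal, B := C^∞(ℝ²)/I(S), and let g : B → C^∞(ℝ) be the algebra homomorphism induced by the pullback of the inclusion x ↦ (x,0) (well defined since functions vanishing on S vanish on the horizontal axis). Then the derivation d/dx of C^∞(ℝ) (sending f to its derivative f′) does not lift along g: there is no derivation D of B such that g(D(b)) = (g(b))′ for all b ∈ B. In particular g is not a coembedding. -/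
open Manifold

/-- Let `S = {(x,y) : xy = 0}` be the coordinate cross in `ℝ²`, `I` its vanishing ideal
in `C^∞(ℝ²)`, `B = C^∞(ℝ²)/I`, and `g : B → C^∞(ℝ)` induced by the pullback of
`x ↦ (x, 0)`. Then the derivation `d/dx` of `C^∞(ℝ)` does not lift along `g`:
there is no derivation `D` of `B` with `g (D b) = (g b)'` for all `b`. -/
theorem cross_not_coembedding
    (I : Ideal C^(⊤ : ℕ∞)⟮𝓘(ℝ, ℝ × ℝ), ℝ × ℝ; 𝓘(ℝ, ℝ), ℝ⟯)
    (hI : ∀ f : C^(⊤ : ℕ∞)⟮𝓘(ℝ, ℝ × ℝ), ℝ × ℝ; 𝓘(ℝ, ℝ), ℝ⟯,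
      f ∈ I ↔ ∀ p : ℝ × ℝ, p.1 * p.2 = 0 → f p = 0)
    (g : (C^(⊤ : ℕ∞)⟮𝓘(ℝ, ℝ × ℝ), ℝ × ℝ; 𝓘(ℝ, ℝ), ℝ⟯ ⧸ I) →ₐ[ℝ]
      C^(⊤ : ℕ∞)⟮𝓘(ℝ, ℝ), ℝ; 𝓘(ℝ, ℝ), ℝ⟯)
    (hg : ∀ f : C^(⊤ : ℕ∞)⟮𝓘(ℝ, ℝ × ℝ), ℝ × ℝ; 𝓘(ℝ, ℝ), ℝ⟯, ∀ x : ℝ,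
      g (Ideal.Quotient.mk I f) x = f (x, 0)) :
    ¬ ∃ D : (C^(⊤ : ℕ∞)⟮𝓘(ℝ, ℝ × ℝ), ℝ × ℝ; 𝓘(ℝ, ℝ), ℝ⟯ ⧸ I) →ₗ[ℝ]
        (C^(⊤ : ℕ∞)⟮𝓘(ℝ, ℝ × ℝ), ℝ × ℝ; 𝓘(ℝ, ℝ), ℝ⟯ ⧸ I),
      (∀ a b, D (a * b) = D a * b + a * D b) ∧
      ∀ b, ∀ x : ℝ, g (D b) x = deriv (g b) x := by
  rintro ⟨D, hD, hd⟩
  let X : C^(⊤ : ℕ∞)⟮𝓘(ℝ, ℝ × ℝ), ℝ × ℝ; 𝓘(ℝ, ℝ), ℝ⟯ := ⟨Prod.fst, contDiff_fst.contMDiff⟩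
  let Y : C^(⊤ : ℕ∞)⟮𝓘(ℝ, ℝ × ℝ), ℝ × ℝ; 𝓘(ℝ, ℝ), ℝ⟯ := ⟨Prod.snd, contDiff_snd.contMDiff⟩
  obtain ⟨u, hu⟩ := Ideal.Quotient.mk_surjective (D (Ideal.Quotient.mk I X))
  obtain ⟨v, hv⟩ := Ideal.Quotient.mk_surjective (D (Ideal.Quotient.mk I Y))
  have hXY : Ideal.Quotient.mk I X * Ideal.Quotient.mk I Y = 0 := by
    rw [← map_mul, Ideal.Quotient.eq_zero_iff_mem, hI]
    exact fun p hp => hp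
  have hmem : u * Y + X * v ∈ I := by
    rw [← Ideal.Quotient.eq_zero_iff_mem, map_add, map_mul, map_mul, hu, hv, ← hD, hXY, map_zero]
  have hu_zero : ∀ t : ℝ, t ≠ 0 → u (0, t) = 0 := by
    intro t ht
    have h : u (0, t) * t + 0 * v (0, t) = 0 := (hI _).1 hmem (0, t) (zero_mul t)
    simpa [ht] using h
  have hu_one : u (0, 0) = 1 := by
    have hid : (g (Ideal.Quotient.mk I X) : ℝ → ℝ) = id := funext (hg X)
    rw [← hg, hu, hd, hid, deriv_id]
  have hcont : Continuous fun t : ℝ => u (0, t) := u.contMDiff.continuous.comp (by fun_prop)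
  have heq : (fun t : ℝ => u (0, t)) = fun _ => 0 :=
    hcont.ext_on (dense_compl_singleton (0 : ℝ)) continuous_const fun t ht => hu_zero t ht
  exact one_ne_zero (hu_one.symm.trans (congrFun heq 0))
end

section
/- Let K be a field, A := K[x,y]/⟨xy⟩ the coordinate ring of the ordinary double point, B := K[x] the univariate polynomial algebra, and π : A → B the surjective K-algebra homomorphism determined by x ↦ x and y ↦ 0. Then the derivation d/dx of K[x] is not in the image of π_*: there is no derivation D of A such that π(D(a)) = (π(a))′ for all a ∈ A, where ′ denotes the formal derivative on K[x]. In particular B is not a submanifold algebra of A via π. -/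
open MvPolynomial

/-- For the ordinary double point `A = K[x,y]/⟨xy⟩` and the quotient map
`π : A → K[x]`, `x ↦ x`, `y ↦ 0`, the derivation `d/dx` of `K[x]` is not in the image
of `π_*`: no derivation `D` of `A` satisfies `π (D a) = (π a)'` for all `a`. -/
theorem double_point_not_submanifold_algebra {K : Type} [Field K]
    (π : (MvPolynomial (Fin 2) K ⧸
        Ideal.span {(X 0 : MvPolynomial (Fin 2) K) * X 1}) →ₐ[K] Polynomial K)
    (hx : π (Ideal.Quotient.mk (Ideal.span {(X 0 : MvPolynomial (Fin 2) K) * X 1})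
        (X 0)) = Polynomial.X)
    (hy : π (Ideal.Quotient.mk (Ideal.span {(X 0 : MvPolynomial (Fin 2) K) * X 1})
        (X 1)) = 0) :
    ¬ ∃ D : (MvPolynomial (Fin 2) K ⧸
          Ideal.span {(X 0 : MvPolynomial (Fin 2) K) * X 1}) →ₗ[K]
        (MvPolynomial (Fin 2) K ⧸
          Ideal.span {(X 0 : MvPolynomial (Fin 2) K) * X 1}),
      (∀ a b, D (a * b) = D a * b + a * D b) ∧
      ∀ a, π (D a) = Polynomial.derivative (π a) := by
  rintro ⟨D, hD, hπ⟩
  let I := Ideal.span {(X 0 : MvPolynomial (Fin 2) K) * X 1}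
  let x := Ideal.Quotient.mk I (X 0)
  let y := Ideal.Quotient.mk I (X 1)
  have hxy : x * y = 0 := by
    rw [← map_mul]
    exact Ideal.Quotient.eq_zero_iff_mem.mpr (Ideal.mem_span_singleton_self _)
  -- The projection onto the other branch, `x ↦ 0`, `y ↦ X`.
  let f : MvPolynomial (Fin 2) K →ₐ[K] Polynomial K := aeval ![0, Polynomial.X]
  have hf : ∀ a ∈ I, f a = 0 := by
    intro a ha
    obtain ⟨b, rfl⟩ := Ideal.mem_span_singleton'.mp ha
    simp [f]
  let ρ : (MvPolynomial (Fin 2) K ⧸ I) →ₐ[K] Polynomial K := Ideal.Quotient.liftₐ I f hf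
  have hρx : ρ x = 0 := by
    change f (X 0) = 0
    simp [f]
  have hρy : ρ y = Polynomial.X := by
    change f (X 1) = Polynomial.X
    simp [f]
  have hρD : ρ (D x) = 0 := by
    have h := congrArg ρ (hD x y)
    rw [hxy, map_zero, map_zero, map_add, map_mul, map_mul, hρx, hρy, zero_mul, add_zero] at h
    exact (mul_eq_zero.mp h.symm).resolve_right Polynomial.X_ne_zero
  have hπD : π (D x) = 1 := by
    rw [hπ x, show π x = Polynomial.X from hx, Polynomial.derivative_X]
  -- The two branches meet at the origin.
  have horigin : (Polynomial.aeval (0 : K)).comp π = (Polynomial.aeval (0 : K)).comp ρ := by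
    apply Ideal.Quotient.algHom_ext
    apply MvPolynomial.algHom_ext
    intro i
    fin_cases i
    · change Polynomial.aeval (0 : K) (π x) = Polynomial.aeval (0 : K) (ρ x)
      rw [show π x = Polynomial.X from hx, hρx]
      simp
    · change Polynomial.aeval (0 : K) (π y) = Polynomial.aeval (0 : K) (ρ y)
      rw [show π y = 0 from hy, hρy]
      simp
  have h := DFunLike.congr_fun horigin (D x)
  simp only [AlgHom.comp_apply] at h
  rw [hπD, hρD, map_one, map_zero] at h
  exact one_ne_zero h
end

section
/- Let A be a finite-dimensional real C*-algebra: a unital normed ℝ-algebra which is a star ring satisfying the C*-identity ‖a*a‖ = ‖a‖² for all a, complete in its norm, and finite-dimensional as an ℝ-vector space. Then every derivation of A is inner: for every ℝ-linear map φ : A → A satisfying φ(ab) = φ(a)b + aφ(b) for all a, b ∈ A, there exists x ∈ A such that φ(a) = xa − ax for all a ∈ A. -/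
/-- The trace of the left regular representation of an algebra. -/
noncomputable def regularTrace (K A : Type*) [CommRing K] [Ring A] [Algebra K A] : A →ₗ[K] K :=
  LinearMap.trace K A ∘ₗ (Algebra.lmul K A).toLinearMap

theorem regularTrace_mul_comm {K A : Type*} [CommRing K] [Ring A] [Algebra K A] (a b : A) :
    regularTrace K A (a * b) = regularTrace K A (b * a) := by
  change LinearMap.trace K A (Algebra.lmul K A (a * b)) =
    LinearMap.trace K A (Algebra.lmul K A (b * a))
  rw [map_mul (Algebra.lmul K A), map_mul (Algebra.lmul K A), LinearMap.trace_mul_comm]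

theorem regularTrace_eq_sum_repr {K A ι : Type*} [CommRing K] [Ring A] [Algebra K A] [Fintype ι]
    (e : Module.Basis ι K A) (a : A) : regularTrace K A a = ∑ i, e.repr (a * e i) i := by
  classical
  change LinearMap.trace K A (Algebra.lmul K A a) = _
  rw [LinearMap.trace_eq_matrix_trace K e, Matrix.trace]
  simp [LinearMap.toMatrix_apply]

open Polynomial in
/-- In a finite-dimensional algebra over a field of characteristic zero, an element of the radical
of the regular trace form is nilpotent. -/
theorem isNilpotent_of_forall_trace_mul_eq_zero {K A : Type*} [Field K] [CharZero K] [Ring A]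
    [Algebra K A] [FiniteDimensional K A] {a : A} (ha : ∀ b, regularTrace K A (a * b) = 0) :
    IsNilpotent a := by
  obtain ⟨q, hq, hdvd⟩ := (minpoly K a).exists_eq_pow_rootMultiplicity_mul_and_not_dvd
    (minpoly.ne_zero (Algebra.IsIntegral.isIntegral a)) 0
  set k := (minpoly K a).rootMultiplicity 0
  rw [C_0, sub_zero] at hq hdvd
  have hcop : IsCoprime (X ^ (k + 1) : K[X]) q :=
    ((irreducible_X.coprime_iff_not_dvd).2 hdvd).pow_left
  obtain ⟨u, v, huv⟩ := hcop
  have hann : aeval a (X ^ (k + 1) * q) = 0 := by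
    rw [pow_succ', mul_assoc, ← hq, map_mul, minpoly.aeval, mul_zero]
  set e : K[X] := u * X ^ (k + 1)
  have he : IsIdempotentElem (aeval a e) := by
    have h : e * e = e - u * v * (X ^ (k + 1) * q) := by
      rw [← eq_sub_iff_add_eq] at huv
      simp only [e] at huv ⊢
      linear_combination (u * X ^ (k + 1)) * huv
    rw [IsIdempotentElem, ← map_mul, h, map_sub, map_mul _ (u * v), hann, mul_zero, sub_zero]
  have htr : regularTrace K A (aeval a e) = 0 := by
    have h : e = X * (u * X ^ k) := by simp only [e]; ring
    rw [h, map_mul, aeval_X]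
    exact ha _
  have he0 : aeval a e = 0 := by
    have h := (LinearMap.IsIdempotentElem.trace_eq_zero_iff (he.map (Algebra.lmul K A))).1 htr
    simpa using LinearMap.congr_fun h 1
  refine ⟨k + 1, ?_⟩
  have h : (X ^ (k + 1) : K[X]) = X ^ (k + 1) * e + v * (X ^ (k + 1) * q) := by
    linear_combination -X ^ (k + 1) * huv
  simpa [he0, hann, -map_mul, map_mul _ _ e, map_mul _ v] using congrArg (aeval a) h

/-- A finite-dimensional algebra whose regular trace form is nondegenerate has only inner
derivations. -/
theorem exists_eq_commutator_of_trace_mul_nondegenerate {K A : Type*} [Field K] [Ring A]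
    [Algebra K A] [FiniteDimensional K A]
    (hA : ∀ a : A, (∀ b, regularTrace K A (a * b) = 0) → a = 0)
    (φ : A →ₗ[K] A) (hφ : ∀ a b, φ (a * b) = φ a * b + a * φ b) :
    ∃ x : A, ∀ a, φ a = x * a - a * x := by
  classical
  let B : LinearMap.BilinForm K A := (LinearMap.mul K A).compr₂ (regularTrace K A)
  have hBa (a b : A) : B a b = regularTrace K A (a * b) := rfl
  have hB : B.Nondegenerate :=
    ⟨fun a h ↦ hA a h, fun a h ↦ hA a fun b ↦ (regularTrace_mul_comm a b).trans (h b)⟩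
  let e := Module.finBasis K A
  let f := B.dualBasis hB e
  have hf (y : A) : y = ∑ j, B y (e j) • f j := by
    conv_lhs => rw [← f.sum_repr y]
    simp only [f, LinearMap.BilinForm.dualBasis_repr_apply]
  have hfe (y : A) (i) : e.repr y i = B (f i) y := by
    conv_rhs => rw [← e.sum_repr y]
    simp_rw [map_sum, map_smul, f, LinearMap.BilinForm.apply_dualBasis_left]
    simp
  have he (y : A) : y = ∑ j, B (f j) y • e j := by
    conv_lhs => rw [← e.sum_repr y]
    simp only [hfe]
  have casimir (a : A) (g : A →ₗ[K] A) : ∑ i, g (e i) * (f i * a) = ∑ i, g (a * e i) * f i := by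
    calc ∑ i, g (e i) * (f i * a)
        = ∑ i, ∑ j, regularTrace K A (f i * a * e j) • (g (e i) * f j) := by
          refine Finset.sum_congr rfl fun i _ ↦ ?_
          conv_lhs => rw [hf (f i * a)]
          simp only [Finset.mul_sum, mul_smul_comm, hBa]
      _ = ∑ j, ∑ i, regularTrace K A (f i * a * e j) • (g (e i) * f j) := Finset.sum_comm
      _ = ∑ j, g (a * e j) * f j := by
          refine Finset.sum_congr rfl fun j _ ↦ ?_
          conv_rhs => rw [he (a * e j)]
          simp only [map_sum, map_smul, Finset.sum_mul, smul_mul_assoc, hBa, mul_assoc]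
  have hone : ∑ i, e i * f i = 1 := by
    refine sub_eq_zero.1 (hA _ fun b ↦ ?_)
    rw [sub_mul, one_mul, map_sub, sub_eq_zero, Finset.sum_mul, map_sum,
      regularTrace_eq_sum_repr e b]
    refine Finset.sum_congr rfl fun i _ ↦ ?_
    rw [hfe, hBa, mul_assoc, regularTrace_mul_comm, mul_assoc]
  refine ⟨∑ i, φ (e i) * f i, fun a ↦ eq_sub_of_add_eq ?_⟩
  calc φ a + a * ∑ i, φ (e i) * f i
      = φ a * ∑ i, e i * f i + a * ∑ i, φ (e i) * f i := by rw [hone, mul_one]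
    _ = ∑ i, φ (a * e i) * f i := by
        simp only [hφ, add_mul, Finset.sum_add_distrib, Finset.mul_sum, mul_assoc]
    _ = (∑ i, φ (e i) * f i) * a := by
        rw [← casimir a φ, Finset.sum_mul]
        simp only [mul_assoc]

/-- A nilpotent self-adjoint element of a C*-ring vanishes. -/
theorem IsSelfAdjoint.eq_zero_of_isNilpotent {A : Type*} [NormedRing A] [StarRing A] [CStarRing A]
    {a : A} (ha : IsSelfAdjoint a) (hn : IsNilpotent a) : a = 0 := by
  obtain ⟨n, hn⟩ := hn
  have h := ha.norm_pow_two_pow n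
  rw [pow_eq_zero_of_le Nat.lt_two_pow_self.le hn, norm_zero] at h
  exact norm_eq_zero.1 (eq_zero_of_pow_eq_zero h.symm)

/-- Every derivation of a finite-dimensional real C*-algebra is inner. -/
theorem finite_dimensional_real_cstar_derivation_inner
    {A : Type} [NormedRing A] [StarRing A] [CStarRing A]
    [NormedAlgebra ℝ A] [CompleteSpace A] [FiniteDimensional ℝ A]
    (φ : A →ₗ[ℝ] A) (hφ : ∀ a b, φ (a * b) = φ a * b + a * φ b) :
    ∃ x : A, ∀ a, φ a = x * a - a * x := by
  refine exists_eq_commutator_of_trace_mul_nondegenerate (fun a ha ↦ ?_) φ hφ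
  have htr (b : A) : regularTrace ℝ A (star a * a * b) = 0 := by
    rw [mul_assoc, regularTrace_mul_comm, mul_assoc, ha]
  exact CStarRing.star_mul_self_eq_zero_iff a |>.1 <|
    (IsSelfAdjoint.star_mul_self a).eq_zero_of_isNilpotent
      (isNilpotent_of_forall_trace_mul_eq_zero htr)
end

section
/- Let A := C^∞(ℝ) be the algebra of smooth real-valued functions on ℝ and B := ℝ[ε]/⟨ε²⟩ the algebra of dual numbers. The map π : A → B defined by π(f) := f(0) + f′(0)·ε is a surjective ℝ-algebra homomorphism, and B is a submanifold algebra of A: for every derivation D of B there exists a derivation D̃ of A such that π(D̃(f)) = D(π(f)) for all f ∈ A. -/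
open Manifold

namespace SmoothFunction

theorem contDiff (f : C^(⊤ : ℕ∞)⟮𝓘(ℝ, ℝ), ℝ; 𝓘(ℝ, ℝ), ℝ⟯) :
    ContDiff ℝ (⊤ : ℕ∞) (f : ℝ → ℝ) :=
  f.contMDiff.contDiff

theorem differentiableAt (f : C^(⊤ : ℕ∞)⟮𝓘(ℝ, ℝ), ℝ; 𝓘(ℝ, ℝ), ℝ⟯) (x : ℝ) :
    DifferentiableAt ℝ (f : ℝ → ℝ) x :=
  ((contDiff f).differentiable (by simp)).differentiableAt

theorem deriv_add (f g : C^(⊤ : ℕ∞)⟮𝓘(ℝ, ℝ), ℝ; 𝓘(ℝ, ℝ), ℝ⟯) (x : ℝ) :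
    deriv (⇑(f + g)) x = deriv (⇑f) x + deriv (⇑g) x := by
  rw [ContMDiffMap.coe_add]
  exact _root_.deriv_add (differentiableAt f x) (differentiableAt g x)

theorem deriv_mul (f g : C^(⊤ : ℕ∞)⟮𝓘(ℝ, ℝ), ℝ; 𝓘(ℝ, ℝ), ℝ⟯) (x : ℝ) :
    deriv (⇑(f * g)) x = deriv (⇑f) x * g x + f x * deriv (⇑g) x := by
  rw [ContMDiffMap.coe_mul]
  exact _root_.deriv_mul (differentiableAt f x) (differentiableAt g x)

theorem deriv_smul (r : ℝ) (f : C^(⊤ : ℕ∞)⟮𝓘(ℝ, ℝ), ℝ; 𝓘(ℝ, ℝ), ℝ⟯) (x : ℝ) :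
    deriv (⇑(r • f)) x = r * deriv (⇑f) x := by
  rw [ContMDiffMap.coe_smul]
  exact deriv_const_smul r (differentiableAt f x)

/-- The 1-jet at the origin, as an algebra homomorphism to the dual numbers. -/
noncomputable def oneJet : C^(⊤ : ℕ∞)⟮𝓘(ℝ, ℝ), ℝ; 𝓘(ℝ, ℝ), ℝ⟯ →ₐ[ℝ] DualNumber ℝ :=
  AlgHom.ofLinearMap
    { toFun := fun f => algebraMap ℝ (DualNumber ℝ) (f 0) + deriv (⇑f) 0 • DualNumber.eps
      map_add' := fun f g => by
        rw [deriv_add, ContMDiffMap.coe_add, Pi.add_apply, map_add, add_smul]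
        abel
      map_smul' := fun r f => by
        rw [deriv_smul, ContMDiffMap.coe_smul, Pi.smul_apply, RingHom.id_apply, smul_add,
          mul_smul, smul_eq_mul, map_mul, Algebra.smul_def r (algebraMap ℝ _ _)] }
    (by
      change algebraMap ℝ (DualNumber ℝ) 1 + deriv (fun _ : ℝ => (1 : ℝ)) 0 • DualNumber.eps = 1
      simp)
    (fun f g => by
      change algebraMap ℝ (DualNumber ℝ) ((f * g) 0) + deriv (⇑(f * g)) 0 • DualNumber.eps =
        (algebraMap ℝ (DualNumber ℝ) (f 0) + deriv (⇑f) 0 • DualNumber.eps) *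
          (algebraMap ℝ (DualNumber ℝ) (g 0) + deriv (⇑g) 0 • DualNumber.eps)
      rw [deriv_mul, ContMDiffMap.coe_mul, Pi.mul_apply]
      ext
      · simp [TrivSqZeroExt.algebraMap_eq_inl]
      · simp [TrivSqZeroExt.algebraMap_eq_inl]
        ring)

theorem oneJet_apply (f : C^(⊤ : ℕ∞)⟮𝓘(ℝ, ℝ), ℝ; 𝓘(ℝ, ℝ), ℝ⟯) :
    oneJet f = algebraMap ℝ (DualNumber ℝ) (f 0) + deriv (⇑f) 0 • DualNumber.eps :=
  rfl

theorem oneJet_surjective : Function.Surjective oneJet := fun z => by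
  refine ⟨⟨fun x => z.fst + z.snd * x, ContDiff.contMDiff (by fun_prop)⟩, ?_⟩
  change algebraMap ℝ (DualNumber ℝ) (z.fst + z.snd * 0) +
    deriv (fun x : ℝ => z.fst + z.snd * x) 0 • DualNumber.eps = z
  have h : deriv (fun x : ℝ => z.fst + z.snd * x) 0 = z.snd := by
    simp
  rw [h]
  ext <;> simp [TrivSqZeroExt.algebraMap_eq_inl]

/-- The vector field `c x d/dx` acting on smooth functions. -/
noncomputable def scaledEuler (c : ℝ) :
    C^(⊤ : ℕ∞)⟮𝓘(ℝ, ℝ), ℝ; 𝓘(ℝ, ℝ), ℝ⟯ →ₗ[ℝ] C^(⊤ : ℕ∞)⟮𝓘(ℝ, ℝ), ℝ; 𝓘(ℝ, ℝ), ℝ⟯ where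
  toFun f := ⟨fun x => c * x * deriv (⇑f) x,
    ((contDiff_const.mul contDiff_id).mul
      (contDiff_infty_iff_deriv.1 (contDiff f)).2).contMDiff⟩
  map_add' f g := by
    ext x
    change c * x * deriv (⇑(f + g)) x = c * x * deriv (⇑f) x + c * x * deriv (⇑g) x
    rw [deriv_add]
    ring
  map_smul' r f := by
    ext x
    change c * x * deriv (⇑(r • f)) x = r * (c * x * deriv (⇑f) x)
    rw [deriv_smul]
    ring

theorem scaledEuler_apply (c : ℝ) (f : C^(⊤ : ℕ∞)⟮𝓘(ℝ, ℝ), ℝ; 𝓘(ℝ, ℝ), ℝ⟯) (x : ℝ) :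
    scaledEuler c f x = c * x * deriv (⇑f) x :=
  rfl

theorem scaledEuler_mul (c : ℝ) (f g : C^(⊤ : ℕ∞)⟮𝓘(ℝ, ℝ), ℝ; 𝓘(ℝ, ℝ), ℝ⟯) :
    scaledEuler c (f * g) = scaledEuler c f * g + f * scaledEuler c g := by
  ext x
  change c * x * deriv (⇑(f * g)) x = c * x * deriv (⇑f) x * g x + f x * (c * x * deriv (⇑g) x)
  rw [deriv_mul]
  ring

theorem deriv_scaledEuler_zero (c : ℝ) (f : C^(⊤ : ℕ∞)⟮𝓘(ℝ, ℝ), ℝ; 𝓘(ℝ, ℝ), ℝ⟯) :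
    deriv (⇑(scaledEuler c f)) 0 = c * deriv (⇑f) 0 := by
  change deriv (fun x => c * x * deriv (⇑f) x) 0 = _
  have hf : DifferentiableAt ℝ (deriv (⇑f)) 0 :=
    (contDiff_infty_iff_deriv.1 (contDiff f)).2.differentiable (by simp) |>.differentiableAt
  exact (((hasDerivAt_id (0 : ℝ)).const_mul c).mul hf.hasDerivAt).deriv.trans (by simp)

end SmoothFunction

namespace DualNumber

/-- A derivation of the dual numbers over `ℝ` is a multiple of `ε d/dε`. -/
theorem leibniz_apply_eq (D : DualNumber ℝ →ₗ[ℝ] DualNumber ℝ)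
    (hD : ∀ a b, D (a * b) = D a * b + a * D b) (a b : ℝ) :
    D (algebraMap ℝ (DualNumber ℝ) a + b • eps) = ((D eps).snd * b) • eps := by
  have h_one : D 1 = 0 := by simpa using hD 1 1
  have h_eps : (D eps).fst = 0 := by
    have h := congrArg TrivSqZeroExt.snd (hD eps eps)
    simp at h
    linarith
  rw [map_add, Algebra.algebraMap_eq_smul_one, map_smul, map_smul, h_one, smul_zero, zero_add]
  ext
  · simp [h_eps]
  · simp [mul_comm]

end DualNumber

/-- The map `π : C^∞(ℝ) → ℝ[ε]`, `π f = f 0 + f' 0 · ε`, is a surjective ℝ-algebra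
homomorphism onto the dual numbers, and the dual numbers are a submanifold algebra of
`C^∞(ℝ)`: every derivation of `ℝ[ε]` lifts along `π` to a derivation of `C^∞(ℝ)`. -/
theorem dual_numbers_submanifold_algebra :
    ∃ π : C^(⊤ : ℕ∞)⟮𝓘(ℝ, ℝ), ℝ; 𝓘(ℝ, ℝ), ℝ⟯ →ₐ[ℝ] DualNumber ℝ,
      (∀ f : C^(⊤ : ℕ∞)⟮𝓘(ℝ, ℝ), ℝ; 𝓘(ℝ, ℝ), ℝ⟯,
        π f = algebraMap ℝ (DualNumber ℝ) (f 0) + deriv (⇑f) 0 • DualNumber.eps) ∧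
      Function.Surjective π ∧
      ∀ D : DualNumber ℝ →ₗ[ℝ] DualNumber ℝ,
        (∀ a b, D (a * b) = D a * b + a * D b) →
        ∃ Dt : C^(⊤ : ℕ∞)⟮𝓘(ℝ, ℝ), ℝ; 𝓘(ℝ, ℝ), ℝ⟯ →ₗ[ℝ] C^(⊤ : ℕ∞)⟮𝓘(ℝ, ℝ), ℝ; 𝓘(ℝ, ℝ), ℝ⟯,
          (∀ a b, Dt (a * b) = Dt a * b + a * Dt b) ∧
          ∀ f, π (Dt f) = D (π f) := by
  refine ⟨SmoothFunction.oneJet, SmoothFunction.oneJet_apply, SmoothFunction.oneJet_surjective,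
    fun D hD => ⟨SmoothFunction.scaledEuler (D DualNumber.eps).snd,
      SmoothFunction.scaledEuler_mul _, fun f => ?_⟩⟩
  rw [SmoothFunction.oneJet_apply, SmoothFunction.oneJet_apply, DualNumber.leibniz_apply_eq D hD,
    SmoothFunction.deriv_scaledEuler_zero, SmoothFunction.scaledEuler_apply]
  simp
end
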